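/- Let W' ⊆ B'⊗C' and W'' ⊆ B''⊗C'' with R(W'') ≤ dim W'' + 2. Then either R(W'⊕W'') = R(W') + R(W''), or all of the following hold: R(W'') = dim W'' + 2, R(W'⊕W'') = R(W') + R(W'') − 1, and e'' = f'' = 1 (for any fixed minimal decomposition V of W'⊕W''). -/

import Mathlib

open TensorProduct

/-- Rank of a subspace `W ⊆ B ⊗ C`: minimal number of rank-one matrices whose span
contains `W`. -/
noncomputable def sRank (k : Type*) [Field k] {B C : Type*} [AddCommGroup B] [Module k B]
    [AddCommGroup C] [Module k C] (W : Submodule k (B ⊗[k] C)) : ℕ :=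
  sInf {r | ∃ s : Fin r → B ⊗[k] C, (∀ i, ∃ b c, s i = b ⊗ₜ[k] c) ∧
    W ≤ Submodule.span k (Set.range s)}

/-- The subspace `S ⊗ T ⊆ B ⊗ C` spanned by simple tensors with factors in the
submodules `S` and `T`. -/
noncomputable def tensorSub (k : Type*) [Field k] {B C : Type*} [AddCommGroup B] [Module k B]
    [AddCommGroup C] [Module k C] (S : Submodule k B) (T : Submodule k C) :
    Submodule k (B ⊗[k] C) :=
  Submodule.span k {x | ∃ b ∈ S, ∃ c ∈ T, x = b ⊗ₜ[k] c}

/-- `V` is a minimal decomposition of `W`: it contains `W`, has dimension `R(W)`, and is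
spanned by the rank-one matrices it contains. -/
def IsMinDecomp (k : Type*) [Field k] {B C : Type*} [AddCommGroup B] [Module k B]
    [AddCommGroup C] [Module k C] (W V : Submodule k (B ⊗[k] C)) : Prop :=
  W ≤ V ∧ Module.finrank k V = sRank k W ∧
    V = Submodule.span k {v | v ∈ V ∧ ∃ b c, v = b ⊗ₜ[k] c}

section Blocks

variable (k : Type*) [Field k] (B' B'' C' C'' : Type*)
  [AddCommGroup B'] [Module k B'] [AddCommGroup B''] [Module k B'']
  [AddCommGroup C'] [Module k C'] [AddCommGroup C''] [Module k C'']

/-- The inclusion `B' ⊗ C' → (B' ⊕ B'') ⊗ (C' ⊕ C'')`. -/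
noncomputable def ιL : B' ⊗[k] C' →ₗ[k] (B' × B'') ⊗[k] (C' × C'') :=
  TensorProduct.map (LinearMap.inl k B' B'') (LinearMap.inl k C' C'')

/-- The inclusion `B'' ⊗ C'' → (B' ⊕ B'') ⊗ (C' ⊕ C'')`. -/
noncomputable def ιR : B'' ⊗[k] C'' →ₗ[k] (B' × B'') ⊗[k] (C' × C'') :=
  TensorProduct.map (LinearMap.inr k B' B'') (LinearMap.inr k C' C'')

/-- The projection `π_{C''} : B ⊗ C → B ⊗ C'` with kernel `B ⊗ C''`. -/
noncomputable def projCbis : (B' × B'') ⊗[k] (C' × C'') →ₗ[k] (B' × B'') ⊗[k] C' :=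
  TensorProduct.map LinearMap.id (LinearMap.fst k C' C'')

/-- The projection `π_{C'} : B ⊗ C → B ⊗ C''` with kernel `B ⊗ C'`. -/
noncomputable def projCprim : (B' × B'') ⊗[k] (C' × C'') →ₗ[k] (B' × B'') ⊗[k] C'' :=
  TensorProduct.map LinearMap.id (LinearMap.snd k C' C'')

/-- The projection `π_{B''} : B ⊗ C → B' ⊗ C` with kernel `B'' ⊗ C`. -/
noncomputable def projBbis : (B' × B'') ⊗[k] (C' × C'') →ₗ[k] B' ⊗[k] (C' × C'') :=
  TensorProduct.map (LinearMap.fst k B' B'') LinearMap.id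

/-- The projection `π_{B'} : B ⊗ C → B'' ⊗ C` with kernel `B' ⊗ C`. -/
noncomputable def projBprim : (B' × B'') ⊗[k] (C' × C'') →ₗ[k] B'' ⊗[k] (C' × C'') :=
  TensorProduct.map (LinearMap.snd k B' B'') LinearMap.id

variable {k B' B'' C' C''}

/-- `E'' ⊆ B''` satisfies `π_{C''}(V) ⊆ (B' ⊕ E'') ⊗ C'`. -/
noncomputable def IsEbisBound (V : Submodule k ((B' × B'') ⊗[k] (C' × C'')))
    (E'' : Submodule k B'') : Prop :=
  V.map (projCbis k B' B'' C' C'') ≤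
    tensorSub k (LinearMap.range (LinearMap.inl k B' B'') ⊔ E''.map (LinearMap.inr k B' B''))
      (⊤ : Submodule k C')

/-- `E' ⊆ B'` satisfies `π_{C'}(V) ⊆ (E' ⊕ B'') ⊗ C''`. -/
noncomputable def IsEprimBound (V : Submodule k ((B' × B'') ⊗[k] (C' × C'')))
    (E' : Submodule k B') : Prop :=
  V.map (projCprim k B' B'' C' C'') ≤
    tensorSub k (E'.map (LinearMap.inl k B' B'') ⊔ LinearMap.range (LinearMap.inr k B' B''))
      (⊤ : Submodule k C'')

/-- `F'' ⊆ C''` satisfies `π_{B''}(V) ⊆ B' ⊗ (C' ⊕ F'')`. -/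
noncomputable def IsFbisBound (V : Submodule k ((B' × B'') ⊗[k] (C' × C'')))
    (F'' : Submodule k C'') : Prop :=
  V.map (projBbis k B' B'' C' C'') ≤
    tensorSub k (⊤ : Submodule k B')
      (LinearMap.range (LinearMap.inl k C' C'') ⊔ F''.map (LinearMap.inr k C' C''))

/-- `F' ⊆ C'` satisfies `π_{B'}(V) ⊆ B'' ⊗ (F' ⊕ C'')`. -/
noncomputable def IsFprimBound (V : Submodule k ((B' × B'') ⊗[k] (C' × C'')))
    (F' : Submodule k C') : Prop :=
  V.map (projBprim k B' B'' C' C'') ≤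
    tensorSub k (⊤ : Submodule k B'')
      (F'.map (LinearMap.inl k C' C'') ⊔ LinearMap.range (LinearMap.inr k C' C''))

end Blocks

section TensorFamilies

variable {k : Type*} [Field k]

theorem finrank_map_add_finrank_le {M N : Type*} [AddCommGroup M] [Module k M] [AddCommGroup N]
    [Module k N] (f : M →ₗ[k] N) {U V : Submodule k M} [FiniteDimensional k V] (hUV : U ≤ V)
    (hU : U ≤ f.ker) :
    Module.finrank k (V.map f) + Module.finrank k U ≤ Module.finrank k V := by
  have h := (f.domRestrict V).finrank_range_add_finrank_ker
  rw [LinearMap.range_domRestrict] at h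
  have hle : Module.finrank k U ≤ Module.finrank k (f.domRestrict V).ker := by
    rw [← (Submodule.comapSubtypeEquivOfLe hUV).finrank_eq]
    exact Submodule.finrank_mono fun x hx => hU hx
  omega

section TwoFactors

variable {B C : Type*} [AddCommGroup B] [Module k B] [AddCommGroup C] [Module k C]

theorem sRank_le_card {ι : Type*} [Fintype ι] {W : Submodule k (B ⊗[k] C)} (b : ι → B) (c : ι → C)
    (h : W ≤ Submodule.span k (Set.range fun i => b i ⊗ₜ[k] c i)) :
    sRank k W ≤ Fintype.card ι := by
  refine Nat.sInf_le ⟨fun i => b ((Fintype.equivFin ι).symm i) ⊗ₜ c ((Fintype.equivFin ι).symm i),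
    fun i => ⟨_, _, rfl⟩, h.trans (Submodule.span_mono ?_)⟩
  rintro _ ⟨i, rfl⟩
  exact ⟨Fintype.equivFin ι i, by simp⟩

/-- Only the nonzero members of a spanning family of rank-one tensors count. -/
theorem sRank_le_card_subtype {ι : Type*} [Fintype ι] (p : ι → Prop) [DecidablePred p]
    {W : Submodule k (B ⊗[k] C)} (b : ι → B) (c : ι → C)
    (h : W ≤ Submodule.span k (Set.range fun i => b i ⊗ₜ[k] c i))
    (h0 : ∀ i, ¬ p i → b i ⊗ₜ[k] c i = 0) :
    sRank k W ≤ Fintype.card {i // p i} := by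
  refine sRank_le_card (fun i : {i // p i} => b i) (fun i => c i) (h.trans ?_)
  rw [Submodule.span_le]
  rintro _ ⟨i, rfl⟩
  by_cases hi : p i
  · exact Submodule.subset_span ⟨⟨i, hi⟩, rfl⟩
  · simp [h0 i hi]

/-- The rank of a subspace is attained by a family of rank-one tensors. -/
theorem exists_family_sRank [FiniteDimensional k B] [FiniteDimensional k C]
    (W : Submodule k (B ⊗[k] C)) :
    ∃ (b : Fin (sRank k W) → B) (c : Fin (sRank k W) → C),
      W ≤ Submodule.span k (Set.range fun i => b i ⊗ₜ[k] c i) := by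
  have hne : {r | ∃ s : Fin r → B ⊗[k] C, (∀ i, ∃ b c, s i = b ⊗ₜ[k] c) ∧
      W ≤ Submodule.span k (Set.range s)}.Nonempty := by
    let e := (Module.finBasis k B).tensorProduct (Module.finBasis k C)
    let f := Fintype.equivFin (Fin (Module.finrank k B) × Fin (Module.finrank k C))
    refine ⟨_, fun i => e (f.symm i), fun i => ⟨_, _, Module.Basis.tensorProduct_apply' _ _ _⟩, ?_⟩
    have hr : Set.range (fun i => e (f.symm i)) = Set.range e := f.symm.surjective.range_comp e
    rw [hr, e.span_eq]
    exact le_top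
  obtain ⟨s, hs, hW⟩ := Nat.sInf_mem hne
  choose b c hbc using hs
  exact ⟨b, c, by rwa [show s = fun i => b i ⊗ₜ[k] c i from funext hbc] at hW⟩

/-- A minimal decomposition has a basis of rank-one tensors. -/
theorem IsMinDecomp.exists_family {W V : Submodule k (B ⊗[k] C)} [FiniteDimensional k V]
    (hV : IsMinDecomp k W V) :
    ∃ (b : Fin (sRank k W) → B) (c : Fin (sRank k W) → C),
      V = Submodule.span k (Set.range fun i => b i ⊗ₜ[k] c i) := by
  obtain ⟨-, hdim, hspan⟩ := hV
  obtain ⟨t, hts, hsp, hli⟩ := exists_linearIndependent k {v | v ∈ V ∧ ∃ b c, v = b ⊗ₜ[k] c}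
  have htV : Submodule.span k t = V := hsp.trans hspan.symm
  have : FiniteDimensional k (Submodule.span k t) := by rwa [htV]
  have hfin : t.Finite := by
    have hb : Module.Basis t k (Submodule.span k (Set.range ((↑) : t → B ⊗[k] C))) :=
      Module.Basis.span hli
    rw [Subtype.range_coe] at hb
    exact Module.Finite.finite_basis hb
  have := hfin.fintype
  have hcard : Fintype.card t = sRank k W := by
    rw [← hdim, ← htV, finrank_span_set_eq_card hli, Set.toFinset_card]
  let f := Fintype.equivFinOfCardEq hcard
  choose b c hbc using fun i : t => (hts i.2).2
  refine ⟨b ∘ f.symm, c ∘ f.symm, ?_⟩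
  have : (fun i => (b ∘ f.symm) i ⊗ₜ[k] (c ∘ f.symm) i) = ((↑) : t → B ⊗[k] C) ∘ f.symm := by
    funext i
    exact (hbc _).symm
  rw [this, f.symm.surjective.range_comp, Subtype.range_coe, htV]

theorem tmul_mem_tensorSub {S : Submodule k B} {T : Submodule k C} {b : B} {c : C}
    (hb : b ∈ S) (hc : c ∈ T) : b ⊗ₜ[k] c ∈ tensorSub k S T :=
  Submodule.subset_span ⟨b, hb, c, hc, rfl⟩

theorem mem_left_of_tmul_mem_tensorSub {S : Submodule k B} {T : Submodule k C} {b : B} {c : C}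
    (hc : c ≠ 0) (h : b ⊗ₜ[k] c ∈ tensorSub k S T) : b ∈ S := by
  obtain ⟨f, hf⟩ := Module.Projective.exists_dual_ne_zero k hc
  have hle : tensorSub k S T ≤ S.comap
      ((TensorProduct.rid k B).toLinearMap ∘ₗ TensorProduct.map LinearMap.id f) := by
    refine Submodule.span_le.2 ?_
    rintro _ ⟨x, hx, y, -, rfl⟩
    simpa using S.smul_mem (f y) hx
  have hb := hle h
  simp only [Submodule.mem_comap, LinearMap.comp_apply, TensorProduct.map_tmul, LinearMap.id_apply,
    LinearEquiv.coe_coe, TensorProduct.rid_tmul] at hb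
  exact (S.smul_mem_iff hf).1 hb

theorem mem_right_of_tmul_mem_tensorSub {S : Submodule k B} {T : Submodule k C} {b : B} {c : C}
    (hb : b ≠ 0) (h : b ⊗ₜ[k] c ∈ tensorSub k S T) : c ∈ T := by
  have hle : tensorSub k S T ≤ (tensorSub k T S).comap (TensorProduct.comm k B C).toLinearMap := by
    refine Submodule.span_le.2 ?_
    rintro _ ⟨x, hx, y, hy, rfl⟩
    exact tmul_mem_tensorSub hy hx
  exact mem_left_of_tmul_mem_tensorSub hb (hle h)

theorem map_span_tmul {D E : Type*} [AddCommGroup D] [Module k D] [AddCommGroup E] [Module k E]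
    {ι : Type*} (b : ι → B) (c : ι → C) (f : B →ₗ[k] D) (g : C →ₗ[k] E) :
    (Submodule.span k (Set.range fun i => b i ⊗ₜ[k] c i)).map (TensorProduct.map f g) =
      Submodule.span k (Set.range fun i => f (b i) ⊗ₜ[k] g (c i)) := by
  rw [Submodule.map_span, ← Set.range_comp]
  rfl

theorem map_comm_span_tmul {ι : Type*} (b : ι → B) (c : ι → C) :
    (Submodule.span k (Set.range fun i => b i ⊗ₜ[k] c i)).map
        (TensorProduct.comm k B C).toLinearMap =
      Submodule.span k (Set.range fun i => c i ⊗ₜ[k] b i) := by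
  rw [Submodule.map_span, ← Set.range_comp]
  rfl

theorem sRank_map_comm_le [FiniteDimensional k B] [FiniteDimensional k C]
    (W : Submodule k (B ⊗[k] C)) :
    sRank k (W.map (TensorProduct.comm k B C).toLinearMap) ≤ sRank k W := by
  obtain ⟨b, c, h⟩ := exists_family_sRank W
  refine (sRank_le_card c b ?_).trans_eq (Fintype.card_fin _)
  rw [← map_comm_span_tmul]
  exact Submodule.map_mono h

theorem sRank_map_comm [FiniteDimensional k B] [FiniteDimensional k C]
    (W : Submodule k (B ⊗[k] C)) :
    sRank k (W.map (TensorProduct.comm k B C).toLinearMap) = sRank k W := by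
  refine le_antisymm (sRank_map_comm_le W) ?_
  have h := sRank_map_comm_le (W.map (TensorProduct.comm k B C).toLinearMap)
  rw [← Submodule.map_comp] at h
  have hid : (TensorProduct.comm k C B).toLinearMap ∘ₗ (TensorProduct.comm k B C).toLinearMap =
      LinearMap.id := TensorProduct.ext' fun _ _ => rfl
  rwa [hid, Submodule.map_id] at h

end TwoFactors

section DirectSum

variable {B' B'' C' C'' : Type*}
  [AddCommGroup B'] [Module k B'] [AddCommGroup B''] [Module k B'']
  [AddCommGroup C'] [Module k C'] [AddCommGroup C''] [Module k C'']

theorem map_comm_directSum (W' : Submodule k (B' ⊗[k] C')) (W'' : Submodule k (B'' ⊗[k] C'')) :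
    (W'.map (ιL k B' B'' C' C'') ⊔ W''.map (ιR k B' B'' C' C'')).map
        (TensorProduct.comm k (B' × B'') (C' × C'')).toLinearMap =
      (W'.map (TensorProduct.comm k B' C').toLinearMap).map (ιL k C' C'' B' B'') ⊔
        (W''.map (TensorProduct.comm k B'' C'').toLinearMap).map (ιR k C' C'' B' B'') := by
  simp only [Submodule.map_sup, ← Submodule.map_comp]
  congr 2 <;> exact TensorProduct.ext' fun _ _ => rfl

/-- The span of the `B''`-components of those `b i` whose partner `c i` has a nonzero
`C'`-component. -/
def leftExcess {ι : Type*} (b : ι → B' × B'') (c : ι → C' × C'') : Submodule k B'' :=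
  Submodule.span k {x | ∃ i, (c i).1 ≠ 0 ∧ (b i).2 = x}

theorem sRank_add_sRank_le_of_leftExcess_eq_bot {ι : Type*} [Fintype ι]
    {W' : Submodule k (B' ⊗[k] C')} {W'' : Submodule k (B'' ⊗[k] C'')}
    (b : ι → B' × B'') (c : ι → C' × C'')
    (hW : W'.map (ιL k B' B'' C' C'') ⊔ W''.map (ιR k B' B'' C' C'') ≤
      Submodule.span k (Set.range fun i => b i ⊗ₜ[k] c i))
    (h0 : leftExcess (k := k) b c = ⊥) :
    sRank k W' + sRank k W'' ≤ Fintype.card ι := by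
  classical
  have hb (i : ι) (hi : (c i).1 ≠ 0) : (b i).2 = 0 := by
    rw [← Submodule.mem_bot k, ← h0]
    exact Submodule.subset_span ⟨i, hi, rfl⟩
  have hW' : W' ≤ Submodule.span k (Set.range fun i => (b i).1 ⊗ₜ[k] (c i).1) := by
    have h := Submodule.map_mono
      (f := TensorProduct.map (LinearMap.fst k B' B'') (LinearMap.fst k C' C''))
      (le_sup_left.trans hW)
    rw [map_span_tmul, ← Submodule.map_comp, ιL, ← TensorProduct.map_comp] at h
    simpa using h
  have hW'' : W'' ≤ Submodule.span k (Set.range fun i => (b i).2 ⊗ₜ[k] (c i).2) := by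
    have h := Submodule.map_mono
      (f := TensorProduct.map (LinearMap.snd k B' B'') (LinearMap.snd k C' C''))
      (le_sup_right.trans hW)
    rw [map_span_tmul, ← Submodule.map_comp, ιR, ← TensorProduct.map_comp] at h
    simpa using h
  have h1 := sRank_le_card_subtype (fun i => (c i).1 ≠ 0) _ _ hW' fun i hi => by
    simp [not_not.1 hi]
  have h2 := sRank_le_card_subtype (fun i => ¬ (c i).1 ≠ 0) _ _ hW'' fun i hi => by
    simp [hb i (not_not.1 hi)]
  rw [Fintype.card_subtype_compl] at h2
  have := Fintype.card_subtype_le fun i => (c i).1 ≠ 0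
  omega

/-- A linear map `B' ⊕ B'' → B'` that is the identity on `B'` can be chosen to kill any family
with linearly independent `B''`-components. -/
theorem exists_retraction_vanishing {κ : Type*} (b : κ → B' × B'')
    (hli : LinearIndependent k fun i => (b i).2) :
    ∃ φ : B' × B'' →ₗ[k] B', φ ∘ₗ LinearMap.inl k B' B'' = LinearMap.id ∧ ∀ i, φ (b i) = 0 := by
  obtain ⟨ψ, hψ⟩ := LinearMap.exists_extend
    (((Module.Basis.span hli).constr k) fun i => (b i).1)
  refine ⟨LinearMap.fst k B' B'' - ψ ∘ₗ LinearMap.snd k B' B'', ?_, fun i => ?_⟩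
  · ext x
    simp
  · have h := LinearMap.congr_fun hψ (Module.Basis.span hli i)
    rw [Module.Basis.constr_basis, LinearMap.comp_apply, Submodule.subtype_apply,
      Module.Basis.span_apply] at h
    simp [h]

theorem sRank_add_finrank_add_finrank_leftExcess_le {ι : Type*} [Fintype ι]
    [FiniteDimensional k B'']
    {W' : Submodule k (B' ⊗[k] C')} {W'' : Submodule k (B'' ⊗[k] C'')}
    (b : ι → B' × B'') (c : ι → C' × C'')
    (hW : W'.map (ιL k B' B'' C' C'') ⊔ W''.map (ιR k B' B'' C' C'') ≤
      Submodule.span k (Set.range fun i => b i ⊗ₜ[k] c i)) :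
    sRank k W' + Module.finrank k W'' + Module.finrank k (leftExcess (k := k) b c) ≤
      Fintype.card ι := by
  classical
  set V := Submodule.span k (Set.range fun i => b i ⊗ₜ[k] c i)
  have hV : Module.finrank k V ≤ Fintype.card ι := finrank_range_le_card _
  have : FiniteDimensional k V := FiniteDimensional.span_of_finite k (Set.finite_range _)
  have hmap : V.map (projCbis k B' B'' C' C'') =
      Submodule.span k (Set.range fun i => b i ⊗ₜ[k] (c i).1) := map_span_tmul _ _ _ _
  have hdim : Module.finrank k (V.map (projCbis k B' B'' C' C'')) + Module.finrank k W'' ≤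
      Module.finrank k V := by
    have hker : W''.map (ιR k B' B'' C' C'') ≤ (projCbis k B' B'' C' C'').ker := by
      rw [LinearMap.le_ker_iff_map, ← Submodule.map_comp, projCbis, ιR, ← TensorProduct.map_comp]
      simp
    have hinj : Function.Injective (ιR k B' B'' C' C'') := by
      have : TensorProduct.map (LinearMap.snd k B' B'') (LinearMap.snd k C' C'') ∘ₗ
          ιR k B' B'' C' C'' = LinearMap.id := by
        rw [ιR, ← TensorProduct.map_comp]
        simp
      exact Function.LeftInverse.injective fun x => LinearMap.congr_fun this x
    rw [(Submodule.equivMapOfInjective _ hinj W'').finrank_eq]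
    exact finrank_map_add_finrank_le _ (le_sup_right.trans hW) hker
  obtain ⟨κ, a, ha, hspan, hli⟩ :=
    exists_linearIndependent' k fun i => b i ⊗ₜ[k] (c i).1
  have := Fintype.ofInjective a ha
  have hκ : Fintype.card κ = Module.finrank k (V.map (projCbis k B' B'' C' C'')) := by
    rw [hmap, ← hspan, finrank_span_eq_card hli]
  obtain ⟨κ₂, a₂, ha₂, hspan₂, hli₂⟩ := exists_linearIndependent' k fun j => (b (a j)).2
  have := Fintype.ofInjective a₂ ha₂
  have hκ₂ : Module.finrank k (leftExcess (k := k) b c) ≤ Fintype.card κ₂ := by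
    rw [← finrank_span_eq_card hli₂, hspan₂]
    refine Submodule.finrank_mono (Submodule.span_le.2 ?_)
    rintro _ ⟨i, hi, rfl⟩
    refine mem_left_of_tmul_mem_tensorSub (T := ⊤)
      (S := (Submodule.span k (Set.range fun j => (b (a j)).2)).comap (LinearMap.snd k B' B'')) hi ?_
    have hmem : b i ⊗ₜ[k] (c i).1 ∈ Submodule.span k (Set.range fun i => b i ⊗ₜ[k] (c i).1) :=
      Submodule.subset_span ⟨i, rfl⟩
    rw [← hspan] at hmem
    refine Submodule.span_le.2 ?_ hmem
    rintro _ ⟨j, rfl⟩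
    exact tmul_mem_tensorSub (Submodule.subset_span ⟨j, rfl⟩) trivial
  obtain ⟨φ, hφ, hφ0⟩ := exists_retraction_vanishing (fun j => b (a (a₂ j))) hli₂
  have hW' : W' ≤ Submodule.span k (Set.range fun j => φ (b (a j)) ⊗ₜ[k] (c (a j)).1) := by
    have h := Submodule.map_mono (f := TensorProduct.map φ LinearMap.id)
      (Submodule.map_mono (f := projCbis k B' B'' C' C'') (le_sup_left.trans hW))
    rw [hmap, ← hspan] at h
    rw [← Submodule.map_comp, ← Submodule.map_comp, projCbis, ιL, ← TensorProduct.map_comp,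
      ← TensorProduct.map_comp] at h
    have h' := h.trans (map_span_tmul (fun j => b (a j)) (fun j => (c (a j)).1) φ
      LinearMap.id).le
    simpa [hφ] using h'
  have hr := sRank_le_card_subtype (fun j => ¬ j ∈ Set.range a₂) _ _ hW' fun j hj => by
    obtain ⟨l, rfl⟩ := not_not.1 hj
    simp [hφ0 l]
  rw [Fintype.card_subtype_compl] at hr
  have hcard : Fintype.card {j // j ∈ Set.range a₂} = Fintype.card κ₂ :=
    Set.card_range_of_injective ha₂
  have hle := Fintype.card_subtype_le fun j => j ∈ Set.range a₂
  omega

theorem mem_range_inl_sup_map_inr {M N : Type*} [AddCommGroup M] [Module k M] [AddCommGroup N]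
    [Module k N] (E : Submodule k N) (x : M × N) :
    x ∈ LinearMap.range (LinearMap.inl k M N) ⊔ E.map (LinearMap.inr k M N) ↔ x.2 ∈ E := by
  rw [Submodule.mem_sup]
  constructor
  · rintro ⟨_, ⟨y, rfl⟩, _, ⟨z, hz, rfl⟩, rfl⟩
    simpa using hz
  · exact fun hx => ⟨_, ⟨x.1, rfl⟩, _, ⟨x.2, hx, rfl⟩, by simp⟩

theorem isEbisBound_span_iff {ι : Type*} (b : ι → B' × B'') (c : ι → C' × C'')
    (E : Submodule k B'') :
    IsEbisBound (Submodule.span k (Set.range fun i => b i ⊗ₜ[k] c i)) E ↔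
      leftExcess b c ≤ E := by
  rw [IsEbisBound, projCbis, map_span_tmul, Submodule.span_le, leftExcess, Submodule.span_le]
  constructor
  · rintro h _ ⟨i, hi, rfl⟩
    exact (mem_range_inl_sup_map_inr _ _).1 (mem_left_of_tmul_mem_tensorSub hi (h ⟨i, rfl⟩))
  · rintro h _ ⟨i, rfl⟩
    by_cases hi : (c i).1 = 0
    · simp [hi]
    · exact tmul_mem_tensorSub ((mem_range_inl_sup_map_inr _ _).2 (h ⟨i, hi, rfl⟩)) trivial

theorem isFbisBound_span_iff {ι : Type*} (b : ι → B' × B'') (c : ι → C' × C'')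
    (F : Submodule k C'') :
    IsFbisBound (Submodule.span k (Set.range fun i => b i ⊗ₜ[k] c i)) F ↔
      leftExcess c b ≤ F := by
  rw [IsFbisBound, projBbis, map_span_tmul, Submodule.span_le, leftExcess, Submodule.span_le]
  constructor
  · rintro h _ ⟨i, hi, rfl⟩
    exact (mem_range_inl_sup_map_inr _ _).1 (mem_right_of_tmul_mem_tensorSub hi (h ⟨i, rfl⟩))
  · rintro h _ ⟨i, rfl⟩
    by_cases hi : (b i).1 = 0
    · simp [hi]
    · exact tmul_mem_tensorSub trivial ((mem_range_inl_sup_map_inr _ _).2 (h ⟨i, hi, rfl⟩))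

theorem sRank_directSum_le [FiniteDimensional k B'] [FiniteDimensional k B'']
    [FiniteDimensional k C'] [FiniteDimensional k C'']
    (W' : Submodule k (B' ⊗[k] C')) (W'' : Submodule k (B'' ⊗[k] C'')) :
    sRank k (W'.map (ιL k B' B'' C' C'') ⊔ W''.map (ιR k B' B'' C' C'')) ≤
      sRank k W' + sRank k W'' := by
  obtain ⟨b', c', h'⟩ := exists_family_sRank W'
  obtain ⟨b'', c'', h''⟩ := exists_family_sRank W''
  refine (sRank_le_card
    (Sum.elim (fun i => LinearMap.inl k B' B'' (b' i)) fun i => LinearMap.inr k B' B'' (b'' i))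
    (Sum.elim (fun i => LinearMap.inl k C' C'' (c' i)) fun i => LinearMap.inr k C' C'' (c'' i))
    ?_).trans_eq (by simp)
  refine sup_le ((Submodule.map_mono h').trans ?_) ((Submodule.map_mono h'').trans ?_)
  · rw [ιL, map_span_tmul]
    refine Submodule.span_mono ?_
    rintro _ ⟨i, rfl⟩
    exact ⟨Sum.inl i, rfl⟩
  · rw [ιR, map_span_tmul]
    refine Submodule.span_mono ?_
    rintro _ ⟨i, rfl⟩
    exact ⟨Sum.inr i, rfl⟩

/-- The dichotomy for a single rank-one decomposition: either its length is at least
`R(W') + R(W'')`, or the excess space is nonzero and gives the usual lower bound. -/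
theorem card_bounds {ι : Type*} [Fintype ι] [FiniteDimensional k B'']
    {W' : Submodule k (B' ⊗[k] C')} {W'' : Submodule k (B'' ⊗[k] C'')}
    (b : ι → B' × B'') (c : ι → C' × C'')
    (hW : W'.map (ιL k B' B'' C' C'') ⊔ W''.map (ιR k B' B'' C' C'') ≤
      Submodule.span k (Set.range fun i => b i ⊗ₜ[k] c i))
    (hlt : Fintype.card ι < sRank k W' + sRank k W'') :
    1 ≤ Module.finrank k (leftExcess (k := k) b c) ∧
    sRank k W' + Module.finrank k W'' + Module.finrank k (leftExcess (k := k) b c) ≤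
      Fintype.card ι := by
  refine ⟨Nat.one_le_iff_ne_zero.2 fun h0 => hlt.not_ge ?_,
    sRank_add_finrank_add_finrank_leftExcess_le b c hW⟩
  exact sRank_add_sRank_le_of_leftExcess_eq_bot b c hW (Submodule.finrank_eq_zero.1 h0)

end DirectSum

end TensorFamilies

/-- If `R(W'') ≤ dim W'' + 2`, then either additivity holds, or `R(W'') = dim W'' + 2`,
`R(W' ⊕ W'') = R(W') + R(W'') − 1`, and for any minimal decomposition `V` the associated
minimal spaces `E''` and `F''` are one-dimensional. -/
theorem additivity_or_gap_two {k : Type*} [Field k] {B' B'' C' C'' : Type*}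
    [AddCommGroup B'] [Module k B'] [FiniteDimensional k B']
    [AddCommGroup B''] [Module k B''] [FiniteDimensional k B'']
    [AddCommGroup C'] [Module k C'] [FiniteDimensional k C']
    [AddCommGroup C''] [Module k C''] [FiniteDimensional k C'']
    (W' : Submodule k (B' ⊗[k] C')) (W'' : Submodule k (B'' ⊗[k] C''))
    (hgap : sRank k W'' ≤ Module.finrank k W'' + 2) :
    sRank k (W'.map (ιL k B' B'' C' C'') ⊔ W''.map (ιR k B' B'' C' C'')) =
      sRank k W' + sRank k W'' ∨
    (sRank k W'' = Module.finrank k W'' + 2 ∧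
     sRank k (W'.map (ιL k B' B'' C' C'') ⊔ W''.map (ιR k B' B'' C' C'')) + 1 =
       sRank k W' + sRank k W'' ∧
     ∀ V : Submodule k ((B' × B'') ⊗[k] (C' × C'')),
       IsMinDecomp k (W'.map (ιL k B' B'' C' C'') ⊔ W''.map (ιR k B' B'' C' C'')) V →
       ∀ E'' : Submodule k B'', IsEbisBound V E'' →
         (∀ E₀ : Submodule k B'', IsEbisBound V E₀ → E'' ≤ E₀) →
       ∀ F'' : Submodule k C'', IsFbisBound V F'' →
         (∀ F₀ : Submodule k C'', IsFbisBound V F₀ → F'' ≤ F₀) →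
       Module.finrank k E'' = 1 ∧ Module.finrank k F'' = 1) := by
  obtain ⟨b, c, hbc⟩ := exists_family_sRank
    (W'.map (ιL k B' B'' C' C'') ⊔ W''.map (ιR k B' B'' C' C''))
  have hle := sRank_directSum_le W' W''
  refine or_iff_not_imp_left.2 fun hne => ?_
  have hlt := lt_of_le_of_ne hle hne
  have hopt := card_bounds b c hbc (by simpa using hlt)
  rw [Fintype.card_fin] at hopt
  refine ⟨by omega, by omega, fun V hV E hE hEmin F hF hFmin => ?_⟩
  have hWV := hV.1
  obtain ⟨b, c, rfl⟩ := hV.exists_family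
  have hEeq : E = leftExcess b c :=
    le_antisymm (hEmin _ ((isEbisBound_span_iff b c _).2 le_rfl))
      ((isEbisBound_span_iff b c _).1 hE)
  have hFeq : F = leftExcess c b :=
    le_antisymm (hFmin _ ((isFbisBound_span_iff b c _).2 le_rfl))
      ((isFbisBound_span_iff b c _).1 hF)
  have h1 := card_bounds b c hWV (by simpa using hlt)
  have hWV' := Submodule.map_mono
    (f := (TensorProduct.comm k (B' × B'') (C' × C'')).toLinearMap) hWV
  rw [map_comm_span_tmul, map_comm_directSum] at hWV'
  have h2 := card_bounds c b hWV' (by simpa [sRank_map_comm] using hlt)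
  rw [sRank_map_comm, LinearEquiv.finrank_map_eq] at h2
  rw [Fintype.card_fin] at h1 h2
  subst hEeq hFeq
  omega
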